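/- Let A be a C*-algebra and let a, b ∈ A with a ≥ 0 and b ≥ 0. Then the following are equivalent: (i) for every c ∈ A with 0 ≤ c ≤ a and every d ∈ A with 0 ≤ d ≤ b, one has c ⊥∞ d; (ii) for every c ∈ A with −a ≤ c ≤ a and every d ∈ A with −b ≤ d ≤ b, one has c ⊥∞ d. -/

import Mathlib

/-- `x` is ∞-orthogonal to `y`: `‖x + k y‖ = max {‖x‖, ‖k y‖}` for all `k ∈ ℝ`. -/
def PerpInf {X : Type*} [NormedAddCommGroup X] [NormedSpace ℝ X] (x y : X) : Prop :=
  ∀ k : ℝ, ‖x + k • y‖ = max ‖x‖ ‖k • y‖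

open CFC in
/-- In a C⋆-algebra, a positive `x` with `star z * x * z = 0` satisfies `x * z = 0`. -/
lemma mul_eq_zero_of_star_mul_mul_eq_zero {A : Type*} [NonUnitalCStarAlgebra A]
    [PartialOrder A] [StarOrderedRing A] {x z : A} (hx : 0 ≤ x) (h : star z * x * z = 0) :
    x * z = 0 := by
  have hs : star (sqrt x) = sqrt x := (IsSelfAdjoint.of_nonneg (sqrt_nonneg x)).star_eq
  have hxx : sqrt x * sqrt x = x := sqrt_mul_sqrt_self x hx
  have hz : sqrt x * z = 0 := by
    rw [← CStarRing.star_mul_self_eq_zero_iff, star_mul, hs, mul_assoc, ← mul_assoc (sqrt x), hxx,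
      ← mul_assoc, h]
  rw [← hxx, mul_assoc, hz, mul_zero]

/-- In a C⋆-algebra, `0 ≤ x ≤ y` and `y * z = 0` imply `x * z = 0`. -/
lemma mul_eq_zero_of_nonneg_of_le {A : Type*} [NonUnitalCStarAlgebra A]
    [PartialOrder A] [StarOrderedRing A] {x y z : A} (hx : 0 ≤ x) (hxy : x ≤ y)
    (h : y * z = 0) : x * z = 0 := by
  refine mul_eq_zero_of_star_mul_mul_eq_zero hx (le_antisymm ?_ (star_left_conjugate_nonneg hx z))
  simpa [mul_assoc, h] using star_left_conjugate_le_conjugate hxy z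

/-- In a C⋆-algebra, `-y ≤ x ≤ y` and `y * z = 0` imply `x * z = 0`. -/
lemma mul_eq_zero_of_neg_le_of_le {A : Type*} [NonUnitalCStarAlgebra A]
    [PartialOrder A] [StarOrderedRing A] {x y z : A} (hyx : -y ≤ x) (hxy : x ≤ y)
    (h : y * z = 0) : x * z = 0 := by
  have h₁ : (x + y) * z = 0 :=
    mul_eq_zero_of_nonneg_of_le (y := y + y) (neg_le_iff_add_nonneg.mp hyx) (by gcongr)
      (by rw [add_mul, h, add_zero])
  simpa [add_mul, h] using h₁

lemma isSelfAdjoint_of_neg_le {A : Type*} [NonUnitalCStarAlgebra A]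
    [PartialOrder A] [StarOrderedRing A] {x y : A} (hy : 0 ≤ y) (hyx : -y ≤ x) :
    IsSelfAdjoint x := by
  simpa using (IsSelfAdjoint.of_nonneg (neg_le_iff_add_nonneg.mp hyx)).sub
    (IsSelfAdjoint.of_nonneg hy)

/-- Truncating a positive element `a` of a C⋆-algebra at height `ε`. -/
lemma exists_truncation {A : Type*} [NonUnitalCStarAlgebra A]
    [PartialOrder A] [StarOrderedRing A] {a : A} (ha : 0 ≤ a) {ε : ℝ} (hε : 0 ≤ ε) :
    ∃ c : A, 0 ≤ c ∧ c ≤ a ∧ ‖c‖ ≤ ε ∧ c * (a - c) = ε • (a - c) := by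
  have hsa : IsSelfAdjoint a := .of_nonneg ha
  have hσ : ∀ t ∈ quasispectrum ℝ a, 0 ≤ t := quasispectrum_nonneg_of_nonneg a ha
  have h0 : min (0 : ℝ) ε = 0 := min_eq_left hε
  have hcont : ContinuousOn (fun t : ℝ ↦ min t ε) (quasispectrum ℝ a) := by fun_prop
  have hsub : a - cfcₙ (fun t : ℝ ↦ min t ε) a = cfcₙ (fun t : ℝ ↦ t - min t ε) a := by
    rw [cfcₙ_sub (fun t : ℝ ↦ t) (fun t : ℝ ↦ min t ε) a, cfcₙ_id' ℝ a]
  refine ⟨cfcₙ (fun t : ℝ ↦ min t ε) a, cfcₙ_nonneg fun t ht ↦ le_min (hσ t ht) hε, ?_,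
    norm_cfcₙ_le fun t ht ↦ ?_, ?_⟩
  · rw [← sub_nonneg, hsub]
    exact cfcₙ_nonneg fun t _ ↦ sub_nonneg.mpr (min_le_left t ε)
  · rw [Real.norm_of_nonneg (le_min (hσ t ht) hε)]
    exact min_le_right t ε
  · rw [hsub, ← cfcₙ_mul .., ← cfcₙ_smul ..]
    refine cfcₙ_congr fun t _ ↦ ?_
    rcases le_total t ε with h | h <;> simp [h]

/-- Absolutely ∞-orthogonal positive elements of a C⋆-algebra have product zero. -/
lemma mul_eq_zero_of_forall_perpInf {A : Type*} [NonUnitalCStarAlgebra A]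
    [PartialOrder A] [StarOrderedRing A] {a b : A} (ha : 0 ≤ a) (hb : 0 ≤ b)
    (h : ∀ c : A, 0 ≤ c → c ≤ a → PerpInf c b) : b * a = 0 := by
  rcases eq_or_ne b 0 with rfl | hb0
  · exact zero_mul a
  have hbn : 0 < ‖b‖ := norm_pos_iff.mpr hb0
  have key (ε : ℝ) (hε : 0 < ε) : ‖b * a‖ ≤ ‖b‖ * ε := by
    obtain ⟨c, hc0, hca, hcε, hmul⟩ := exists_truncation ha hε.le
    set k := ε / ‖b‖
    have hk : 0 < k := by positivity
    set z := a - c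
    have hz : star z = z := (IsSelfAdjoint.of_nonneg (sub_nonneg.mpr hca)).star_eq
    have hnorm : ‖c + k • b‖ ≤ ε := by
      rw [h c hc0 hca k, norm_smul, Real.norm_of_nonneg hk.le, div_mul_cancel₀ _ hbn.ne']
      exact max_le hcε le_rfl
    have hconj : star z * (c + k • b) * z ≤ ε • (star z * z) :=
      (CStarAlgebra.star_left_conjugate_le_norm_smul
        (IsSelfAdjoint.of_nonneg (add_nonneg hc0 (smul_nonneg hk.le hb)))).trans
        (smul_le_smul_of_nonneg_right hnorm (star_mul_self_nonneg z))
    have hkb : star z * (k • b) * z = 0 := by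
      refine le_antisymm ?_ (star_left_conjugate_nonneg (smul_nonneg hk.le hb) z)
      rw [mul_add, add_mul, mul_assoc _ c, hmul, mul_smul_comm] at hconj
      simpa using hconj
    have hbz : star z * b * z = 0 := by
      rw [mul_smul_comm, smul_mul_assoc] at hkb
      exact (smul_eq_zero.mp hkb).resolve_left hk.ne'
    have hbac : b * a = b * c := by
      rw [← sub_eq_zero, ← mul_sub]
      exact mul_eq_zero_of_star_mul_mul_eq_zero hb hbz
    rw [hbac]
    exact (norm_mul_le b c).trans (by gcongr)
  rw [← norm_le_zero_iff]
  refine le_of_forall_pos_le_add fun δ hδ ↦ ?_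
  simpa [mul_div_cancel₀ _ hbn.ne'] using key (δ / ‖b‖) (by positivity)

theorem absolutely_perpInf_iff_extensively_perpInf {A : Type*} [NonUnitalCStarAlgebra A]
    [PartialOrder A] [StarOrderedRing A] (a b : A) (ha : 0 ≤ a) (hb : 0 ≤ b) :
    (∀ c : A, 0 ≤ c → c ≤ a → ∀ d : A, 0 ≤ d → d ≤ b → PerpInf c d) ↔
      (∀ c : A, -a ≤ c → c ≤ a → ∀ d : A, -b ≤ d → d ≤ b → PerpInf c d) := by
  refine ⟨fun h c hac hca d hbd hdb k ↦ ?_, fun h c hc hca d hd hdb ↦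
    h c ((neg_nonpos.mpr ha).trans hc) hca d ((neg_nonpos.mpr hb).trans hd) hdb⟩
  have hba : b * a = 0 :=
    mul_eq_zero_of_forall_perpInf ha hb fun c hc hca ↦ h c hc hca b hb le_rfl
  have hda : d * a = 0 := mul_eq_zero_of_neg_le_of_le hbd hdb hba
  have hc := isSelfAdjoint_of_neg_le ha hac
  have hd := isSelfAdjoint_of_neg_le hb hbd
  have had : a * d = 0 := by
    simpa [(IsSelfAdjoint.of_nonneg ha).star_eq, hd.star_eq] using congrArg star hda
  have hcd : c * d = 0 := mul_eq_zero_of_neg_le_of_le hac hca had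
  exact hc.norm_add_eq_max ((IsSelfAdjoint.all k).smul hd) (by rw [mul_smul_comm, hcd, smul_zero])
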